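/- arXiv:2002.04543 — 2 statements merged into one kernel-verified Lean document; each statement's English description precedes it below -/
import Mathlib

section
/- For every c in the interval (1/2, 1], it holds that P(c) = c − R·c·ln(2c). -/
open Real

noncomputable def R : ℝ := 1 / (1 + Real.log 2)

noncomputable def f (x : ℝ) : ℝ :=
  if x ≤ R then 1/2 else (2 * Real.exp 1) ^ (x - 1)

noncomputable def F (x : ℝ) : ℝ :=
  if x ≤ R then x/2 else R * (2 * Real.exp 1) ^ (x - 1)

noncomputable def P (c : ℝ) : ℝ := ∫ y in (0:ℝ)..1, min (f y) c

noncomputable def Q (c : ℝ) : ℝ := ∫ y in (0:ℝ)..1, max (c - f y) 0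

noncomputable def xic : ℝ := (1 + (2/3) * Real.log (4/3)) * R - 2/3

noncomputable def phi : ℝ := (2/3) * xic / (2/3 - R + xic)

noncomputable def xi (x : ℝ) : ℝ :=
  if x ≤ 1/3 then xic / x else 9 * xic * (1 - 2 * x)

noncomputable def T (a b : ℝ) : ℝ := (a + b - 1/2) * (xi b - xi a)

noncomputable def pile (x : ℝ) : ℝ := max (2/3) (2 * x)

lemma R_pos : 0 < R := by
  have := Real.log_pos (one_lt_two)
  unfold R
  positivity

lemma R_mul_one_add_log_two : R * (1 + Real.log 2) = 1 := by
  have := Real.log_pos (one_lt_two)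
  unfold R
  field_simp

lemma two_mul_exp_one_rpow (x : ℝ) :
    (2 * Real.exp 1) ^ (x - 1) = Real.exp ((x - 1) / R) := by
  rw [Real.rpow_def_of_pos (by positivity), Real.log_mul (by norm_num) (Real.exp_ne_zero 1),
    Real.log_exp]
  congr 1
  unfold R
  rw [div_div_eq_mul_div, div_one]
  ring

lemma exp_sub_one_div_R_le_iff {c : ℝ} (hc : 0 < c) (x : ℝ) :
    Real.exp ((x - 1) / R) ≤ c ↔ x ≤ 1 + R * Real.log c := by
  rw [← Real.le_log_iff_exp_le hc, div_le_iff₀ R_pos]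
  constructor <;> intro h <;> linarith

lemma one_add_R_mul_log_half : 1 + R * Real.log (1 / 2) = R := by
  rw [one_div, Real.log_inv]
  linarith [R_mul_one_add_log_two]

lemma f_eq_max (x : ℝ) : f x = max (1 / 2) (Real.exp ((x - 1) / R)) := by
  have h := exp_sub_one_div_R_le_iff (c := 1 / 2) (by norm_num) x
  rw [one_add_R_mul_log_half] at h
  unfold f
  split_ifs with hx
  · exact (max_eq_left (h.2 hx)).symm
  · rw [two_mul_exp_one_rpow, max_eq_right (le_of_not_ge (mt h.1 hx))]

lemma continuous_f : Continuous f := by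
  rw [funext f_eq_max]
  fun_prop

lemma integral_exp_sub_one_div_R (a b : ℝ) :
    ∫ y in a..b, Real.exp ((y - 1) / R) =
      R * Real.exp ((b - 1) / R) - R * Real.exp ((a - 1) / R) := by
  refine intervalIntegral.integral_eq_sub_of_hasDerivAt
    (f := fun y => R * Real.exp ((y - 1) / R)) (fun y _ => ?_)
    (Continuous.intervalIntegrable (by fun_prop) _ _)
  have h := ((((hasDerivAt_id y).sub_const 1).div_const R).exp).const_mul R
  refine h.congr_deriv ?_
  have := R_pos.ne'
  simp only [id]
  field_simp

theorem stmt_4 : ∀ c ∈ Set.Ioc (1/2 : ℝ) 1, P c = c - R * c * Real.log (2 * c) := by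
  rintro c ⟨hc, hc1⟩
  have hc0 : 0 < c := by linarith
  have hR := R_pos
  set t := 1 + R * Real.log c with ht
  have hRt : R ≤ t := by
    rw [← one_add_R_mul_log_half, ht]
    gcongr
  have ht1 : t ≤ 1 := by
    have := mul_nonpos_of_nonneg_of_nonpos hR.le (Real.log_nonpos hc0.le hc1)
    linarith
  have hint (a b : ℝ) : IntervalIntegrable (fun y => min (f y) c) MeasureTheory.volume a b :=
    (continuous_f.min continuous_const).intervalIntegrable a b
  have left : ∫ y in (0:ℝ)..R, min (f y) c = R * (1 / 2) := by
    rw [intervalIntegral.integral_congr (g := fun _ => (1 / 2 : ℝ))]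
    · simp
    · intro y hy
      rw [Set.uIcc_of_le hR.le] at hy
      simp only [f, if_pos hy.2]
      exact min_eq_left hc.le
  have middle : ∫ y in R..t, min (f y) c = R * c - R * (1 / 2) := by
    rw [intervalIntegral.integral_congr (g := fun y => Real.exp ((y - 1) / R))]
    · have h1 : (t - 1) / R = Real.log c := by
        rw [ht]
        field_simp
        ring
      have h2 : (R - 1) / R = Real.log (1 / 2) := by
        rw [div_eq_iff hR.ne']
        linarith [one_add_R_mul_log_half]
      rw [integral_exp_sub_one_div_R, h1, h2, Real.exp_log hc0, Real.exp_log (by norm_num)]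
    · intro y hy
      rw [Set.uIcc_of_le hRt] at hy
      have h1 := (exp_sub_one_div_R_le_iff hc0 y).2 hy.2
      have h2 : 1 / 2 ≤ Real.exp ((y - 1) / R) := by
        rw [← Real.log_le_iff_le_exp (by norm_num), le_div_iff₀ hR]
        linarith [one_add_R_mul_log_half, hy.1]
      simp only [f_eq_max, max_eq_right h2, min_eq_left h1]
  have right : ∫ y in t..1, min (f y) c = (1 - t) * c := by
    rw [intervalIntegral.integral_congr (g := fun _ => c)]
    · simp
    · intro y hy
      rw [Set.uIcc_of_le ht1] at hy
      have h : c ≤ Real.exp ((y - 1) / R) := by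
        rw [← Real.log_le_iff_le_exp hc0, le_div_iff₀ hR]
        linarith [hy.1]
      simp only [f_eq_max]
      exact min_eq_right (h.trans (le_max_right _ _))
  rw [P, ← intervalIntegral.integral_add_adjacent_intervals (hint 0 t) (hint t 1),
    ← intervalIntegral.integral_add_adjacent_intervals (hint 0 R) (hint R t),
    left, middle, right, Real.log_mul (by norm_num) hc0.ne', ht]
  linear_combination c * R_mul_one_add_log_two
end

section
/- For every x in the interval [φ, 1/3], it holds that 2/3 − (2/3 − φ)·ξ(x) ≥ R. -/
open Real

theorem R_lt_two_thirds : R < 2/3 := by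
  have h := Real.log_two_gt_d9
  rw [R, div_lt_div_iff₀ (by linarith) (by norm_num)]
  linarith

theorem xic_pos : 0 < xic := by
  have h2 := Real.log_two_gt_d9
  have h := Real.log_lt_sub_one_of_pos (x := 3/2) (by norm_num) (by norm_num)
  have h43 : Real.log (4/3) = Real.log 2 - Real.log (3/2) := by
    rw [← Real.log_div (by norm_num) (by norm_num)]
    norm_num
  have hlt : 2/3 < (1 + (2/3) * Real.log (4/3)) / (1 + Real.log 2) := by
    rw [lt_div_iff₀ (by linarith), h43]
    linarith
  rw [xic, R, mul_one_div]
  linarith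

theorem phi_pos : 0 < phi := by
  have hR := R_lt_two_thirds
  have hc := xic_pos
  exact div_pos (by linarith) (by linarith)

theorem two_thirds_sub_phi_mul_xic : (2/3 - phi) * xic = (2/3 - R) * phi := by
  have hR := R_lt_two_thirds
  have hc := xic_pos
  have hd : 2/3 - R + xic ≠ 0 := by linarith
  have h : phi * (2/3 - R + xic) = (2/3) * xic := div_mul_cancel₀ _ hd
  linarith

theorem stmt_14 : ∀ x ∈ Set.Icc phi (1/3 : ℝ), 2/3 - (2/3 - phi) * xi x ≥ R := by
  rintro x ⟨hφ, hx⟩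
  have hR := R_lt_two_thirds
  have hx0 : 0 < x := phi_pos.trans_le hφ
  have h : (2/3 - phi) * xi x ≤ 2/3 - R := by
    rw [xi, if_pos hx, ← mul_div_assoc, two_thirds_sub_phi_mul_xic, div_le_iff₀ hx0]
    exact mul_le_mul_of_nonneg_left hφ (by linarith)
  linarith
end
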